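/- arXiv:2605.18207 — 8 statements merged into one kernel-verified Lean document; each statement's English description precedes it below -/
import Mathlib

section
/- Let R > 0, r₁ ∈ (0, R) and a > R be real numbers. Let U : ℝ → ℝ be continuous with U(r) ≥ 0 for all r ∈ (0, r₁) and U(r) ≤ 0 for all r ∈ (r₁, R). Let u : ℝ → ℝ be continuously differentiable on ℝ and twice differentiable on (0, R) with u''(r) = U(r)·u(r) for all r ∈ (0, R), u(0) = 0, u(r) = 1 - r/a for all r ≥ R, and u(r) > 0 for all r ∈ (0, R]. Then the effective range r₀ = 2∫₀ᴿ ((1 - r/a)² - u(r)²) dr is strictly positive. -/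
/-- Positivity of the effective range for a finite-range potential with a
repulsive core on `(0, r₁)` and an attractive tail on `(r₁, R)`, provided the
scattering length satisfies `a > R`. -/
theorem effective_range_pos_core
    (R r₁ a : ℝ) (hR : 0 < R) (hr₁ : r₁ ∈ Set.Ioo 0 R) (ha : R < a)
    (U : ℝ → ℝ) (hU : Continuous U)
    (hUrep : ∀ r ∈ Set.Ioo 0 r₁, 0 ≤ U r)
    (hUatt : ∀ r ∈ Set.Ioo r₁ R, U r ≤ 0)
    (u : ℝ → ℝ) (hu : ContDiff ℝ 1 u)
    (hu'' : ∀ r ∈ Set.Ioo 0 R, HasDerivAt (deriv u) (U r * u r) r)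
    (hu0 : u 0 = 0)
    (huR : ∀ r, R ≤ r → u r = 1 - r / a)
    (hupos : ∀ r ∈ Set.Ioc 0 R, 0 < u r) :
    0 < 2 * ∫ r in (0:ℝ)..R, ((1 - r / a) ^ 2 - u r ^ 2) := by
  obtain ⟨h1, h2⟩ := hr₁
  have ha0 : 0 < a := hR.trans ha
  have hud : Differentiable ℝ u := hu.differentiable (by norm_num)
  have hdc : Continuous (deriv u) := hu.continuous_deriv (by norm_num)
  have hchi : ∀ r : ℝ, HasDerivAt (fun r : ℝ => 1 - r / a) (-(1 / a)) r := fun r => by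
    simpa using ((hasDerivAt_id r).div_const a).const_sub 1
  have hdR : deriv u R = -(1 / a) := by
    have e1 : HasDerivWithinAt u (deriv u R) (Set.Ici R) R :=
      (hud R).hasDerivAt.hasDerivWithinAt
    have e2 : HasDerivWithinAt u (-(1 / a)) (Set.Ici R) R :=
      (hchi R).hasDerivWithinAt.congr (fun x hx => huR x hx) (huR R le_rfl)
    exact (uniqueDiffOn_Ici R R Set.self_mem_Ici).eq_deriv _ e1 e2
  have hanti : AntitoneOn (deriv u) (Set.Icc r₁ R) := by
    apply antitoneOn_of_deriv_nonpos (convex_Icc _ _) hdc.continuousOn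
    · rw [interior_Icc]
      intro x hx
      exact (hu'' x ⟨h1.trans hx.1, hx.2⟩).differentiableAt.differentiableWithinAt
    · rw [interior_Icc]
      intro x hx
      rw [(hu'' x ⟨h1.trans hx.1, hx.2⟩).deriv]
      exact mul_nonpos_of_nonpos_of_nonneg (hUatt x hx)
        (hupos x ⟨h1.trans hx.1, hx.2.le⟩).le
  have hmono : MonotoneOn (deriv u) (Set.Icc 0 r₁) := by
    apply monotoneOn_of_deriv_nonneg (convex_Icc _ _) hdc.continuousOn
    · rw [interior_Icc]
      intro x hx
      exact (hu'' x ⟨hx.1, hx.2.trans h2⟩).differentiableAt.differentiableWithinAt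
    · rw [interior_Icc]
      intro x hx
      rw [(hu'' x ⟨hx.1, hx.2.trans h2⟩).deriv]
      exact mul_nonneg (hUrep x hx) (hupos x ⟨hx.1, (hx.2.trans h2).le⟩).le
  have hv : ∀ r : ℝ, HasDerivAt (fun r : ℝ => u r - (1 - r / a)) (deriv u r - -(1 / a)) r :=
    fun r => (hud r).hasDerivAt.sub (hchi r)
  have hvm : MonotoneOn (fun r : ℝ => u r - (1 - r / a)) (Set.Icc r₁ R) := by
    apply monotoneOn_of_deriv_nonneg (convex_Icc _ _)
    · exact fun x _ => (hv x).continuousAt.continuousWithinAt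
    · exact fun x _ => (hv x).differentiableAt.differentiableWithinAt
    · rw [interior_Icc]
      intro x hx
      rw [(hv x).deriv]
      have := hanti ⟨hx.1.le, hx.2.le⟩ ⟨h2.le, le_rfl⟩ hx.2.le
      linarith
  have hout : ∀ r ∈ Set.Icc r₁ R, u r ≤ 1 - r / a := by
    intro r hr
    have h := hvm hr ⟨h2.le, le_rfl⟩ hr.2
    have h' := huR R le_rfl
    simp only at h
    linarith
  have hconv : ConvexOn ℝ (Set.Icc 0 r₁) u := by
    apply MonotoneOn.convexOn_of_deriv (convex_Icc _ _) hud.continuous.continuousOn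
      hud.differentiableOn
    exact hmono.mono interior_subset
  have hin : ∀ r ∈ Set.Icc 0 r₁, u r ≤ 1 - r / a := by
    intro r hr
    have ht0 : 0 ≤ r / r₁ := div_nonneg hr.1 h1.le
    have ht1 : r / r₁ ≤ 1 := (div_le_one h1).2 hr.2
    have h := hconv.2 (x := 0) ⟨le_rfl, h1.le⟩ (y := r₁) ⟨h1.le, le_rfl⟩
      (sub_nonneg.2 ht1) ht0 (by ring)
    have e : r / r₁ * r₁ = r := div_mul_cancel₀ r h1.ne'
    simp only [smul_eq_mul, mul_zero, zero_add, hu0, e] at h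
    have h3 := mul_le_mul_of_nonneg_left (hout r₁ ⟨le_rfl, h2.le⟩) ht0
    have h4 : r / r₁ * (1 - r₁ / a) = r / r₁ - r / a := by field_simp
    linarith
  apply mul_pos two_pos
  apply intervalIntegral.integral_pos hR
  · have := hud.continuous
    fun_prop
  · intro x hx
    have hle : u x ≤ 1 - x / a := by
      rcases le_total x r₁ with h | h
      · exact hin x ⟨hx.1.le, h⟩
      · exact hout x ⟨h, hx.2⟩
    have := hupos x hx
    exact sub_nonneg.2 (pow_le_pow_left₀ this.le hle 2)
  · exact ⟨0, ⟨le_rfl, hR.le⟩, by simp [hu0]⟩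
end

section
/- Let R > 0, r₁ ∈ (0, R) and a > R be real numbers. Let U : ℝ → ℝ be continuous with U(r) ≥ 0 for all r ∈ (0, r₁) and U(r) ≤ 0 for all r ∈ (r₁, R). Let u : ℝ → ℝ be continuously differentiable on ℝ and twice differentiable on (0, R) with u''(r) = U(r)·u(r) for all r ∈ (0, R), u(0) = 0, u(r) = 1 - r/a for all r ≥ R, and u(r) > 0 for all r ∈ (0, R]. Then 1 - r/a ≥ u(r) for all r ∈ [0, R]; that is, the true zero-energy wave function lies below the asymptotic free solution throughout the interaction region. -/
/-- For a finite-range potential with a repulsive core on `(0, r₁)` and an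
attractive tail on `(r₁, R)`, with scattering length `a > R`, the true
zero-energy wave function lies below the asymptotic free solution `1 - r/a`
throughout the interaction region `[0, R]`. -/
theorem wave_function_below_asymptotic
    (R r₁ a : ℝ) (hR : 0 < R) (hr₁ : r₁ ∈ Set.Ioo 0 R) (ha : R < a)
    (U : ℝ → ℝ) (hU : Continuous U)
    (hUrep : ∀ r ∈ Set.Ioo 0 r₁, 0 ≤ U r)
    (hUatt : ∀ r ∈ Set.Ioo r₁ R, U r ≤ 0)
    (u : ℝ → ℝ) (hu : ContDiff ℝ 1 u)
    (hu'' : ∀ r ∈ Set.Ioo 0 R, HasDerivAt (deriv u) (U r * u r) r)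
    (hu0 : u 0 = 0)
    (huR : ∀ r, R ≤ r → u r = 1 - r / a)
    (hupos : ∀ r ∈ Set.Ioc 0 R, 0 < u r) :
    ∀ r ∈ Set.Icc 0 R, u r ≤ 1 - r / a := by
  obtain ⟨h0, h1⟩ := hr₁
  have hapos : 0 < a := hR.trans ha
  have hd : Differentiable ℝ u := hu.differentiable (by norm_num)
  have hc : Continuous (deriv u) := hu.continuous_deriv (by norm_num)
  have hline : ∀ x : ℝ, HasDerivAt (fun r : ℝ => 1 - r / a) (-(1 / a)) x := fun x => by
    simpa using ((hasDerivAt_id x).div_const a).const_sub 1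
  have hdR : deriv u R = -(1 / a) := by
    have e1 : HasDerivWithinAt u (deriv u R) (Set.Ici R) R := (hd R).hasDerivAt.hasDerivWithinAt
    have e2 : HasDerivWithinAt u (-(1 / a)) (Set.Ici R) R :=
      ((hline R).hasDerivWithinAt).congr (fun x hx => huR x hx) (huR R le_rfl)
    exact (uniqueDiffWithinAt_Ici R).eq_deriv _ e1 e2
  have hanti : AntitoneOn (deriv u) (Set.Icc r₁ R) := by
    apply antitoneOn_of_deriv_nonpos (convex_Icc _ _) hc.continuousOn
    · rw [interior_Icc]
      intro x hx
      exact (hu'' x ⟨h0.trans hx.1, hx.2⟩).differentiableAt.differentiableWithinAt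
    · rw [interior_Icc]
      intro x hx
      rw [(hu'' x ⟨h0.trans hx.1, hx.2⟩).deriv]
      exact mul_nonpos_of_nonpos_of_nonneg (hUatt x hx) (hupos x ⟨h0.trans hx.1, hx.2.le⟩).le
  have hmono : MonotoneOn (deriv u) (Set.Icc 0 r₁) := by
    apply monotoneOn_of_deriv_nonneg (convex_Icc _ _) hc.continuousOn
    · rw [interior_Icc]
      intro x hx
      exact (hu'' x ⟨hx.1, hx.2.trans h1⟩).differentiableAt.differentiableWithinAt
    · rw [interior_Icc]
      intro x hx
      rw [(hu'' x ⟨hx.1, hx.2.trans h1⟩).deriv]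
      exact mul_nonneg (hUrep x hx) (hupos x ⟨hx.1, (hx.2.trans h1).le⟩).le
  have hΔ : ∀ x, HasDerivAt (fun r : ℝ => (1 - r / a) - u r) (-(1 / a) - deriv u x) x :=
    fun x => (hline x).sub (hd x).hasDerivAt
  have hΔanti : AntitoneOn (fun r : ℝ => (1 - r / a) - u r) (Set.Icc r₁ R) := by
    apply antitoneOn_of_deriv_nonpos (convex_Icc _ _)
    · exact fun x _ => (hΔ x).continuousAt.continuousWithinAt
    · exact fun x _ => (hΔ x).differentiableAt.differentiableWithinAt
    · rw [interior_Icc]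
      intro x hx
      rw [(hΔ x).deriv]
      have := hanti ⟨hx.1.le, hx.2.le⟩ ⟨h1.le, le_rfl⟩ hx.2.le
      rw [hdR] at this
      linarith
  have htail : ∀ r ∈ Set.Icc r₁ R, u r ≤ 1 - r / a := by
    intro r hr
    have := hΔanti hr ⟨h1.le, le_rfl⟩ hr.2
    simp only [huR R le_rfl] at this
    linarith
  have hconv : ConvexOn ℝ (Set.Icc 0 r₁) u := by
    apply MonotoneOn.convexOn_of_deriv (convex_Icc _ _) hd.continuous.continuousOn
      hd.differentiableOn
    exact hmono.mono interior_subset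
  intro r hr
  rcases le_total r₁ r with h | h
  · exact htail r ⟨h, hr.2⟩
  · have hs : 0 ≤ r / r₁ := div_nonneg hr.1 h0.le
    have hs1 : r / r₁ ≤ 1 := (div_le_one h0).2 h
    have := hconv.2 (Set.left_mem_Icc.2 h0.le) (Set.right_mem_Icc.2 h0.le)
      (sub_nonneg.2 hs1) hs (by ring)
    have hrr : r / r₁ * r₁ = r := div_mul_cancel₀ r h0.ne'
    simp only [smul_eq_mul, mul_zero, zero_add, hu0, hrr] at this
    have ht := mul_le_mul_of_nonneg_left (htail r₁ ⟨le_rfl, h1.le⟩) hs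
    have : r / r₁ * (1 - r₁ / a) = r / r₁ - r / a := by
      rw [mul_sub, mul_one, ← mul_div_assoc, hrr]
    linarith
end

section
/- Let R > 0, let U : ℝ → ℝ be continuous on [0, R], and let k₁, k₂ ∈ ℝ. For i = 1, 2 let uᵢ : ℝ → ℝ be continuously differentiable on [0, R] and twice differentiable on (0, R) with -uᵢ''(r) + U(r)·uᵢ(r) = kᵢ²·uᵢ(r) on (0, R) and uᵢ(0) = 0, and let χᵢ : ℝ → ℝ be continuously differentiable on [0, R] and twice differentiable on (0, R) with -χᵢ''(r) = kᵢ²·χᵢ(r) on (0, R) and χᵢ(0) = 1. Assume uᵢ(R) = χᵢ(R) and uᵢ'(R) = χᵢ'(R) for i = 1, 2. Then χ₂'(0) - χ₁'(0) = (k₂² - k₁²) · ∫₀ᴿ (χ₁(r)·χ₂(r) - u₁(r)·u₂(r)) dr. -/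
/-- Fundamental exact identity of the effective range expansion: for two
energies `k₁², k₂²`, with true solutions `u₁, u₂` (vanishing at the origin) and
free comparison solutions `χ₁, χ₂` (normalized to `1` at the origin) that match
the true solutions at `r = R`,
`χ₂'(0) - χ₁'(0) = (k₂² - k₁²) ∫₀ᴿ (χ₁ χ₂ - u₁ u₂)`. -/
theorem effective_range_fundamental_identity
    (R : ℝ) (hR : 0 < R)
    (U : ℝ → ℝ) (hU : ContinuousOn U (Set.Icc 0 R))
    (k₁ k₂ : ℝ)
    (u₁ u₂ u₁' u₂' χ₁ χ₂ χ₁' χ₂' : ℝ → ℝ)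
    (hu₁' : ∀ r ∈ Set.Icc 0 R, HasDerivAt u₁ (u₁' r) r)
    (hu₂' : ∀ r ∈ Set.Icc 0 R, HasDerivAt u₂ (u₂' r) r)
    (hu₁'c : ContinuousOn u₁' (Set.Icc 0 R))
    (hu₂'c : ContinuousOn u₂' (Set.Icc 0 R))
    (hu₁'' : ∀ r ∈ Set.Ioo 0 R, HasDerivAt u₁' (U r * u₁ r - k₁ ^ 2 * u₁ r) r)
    (hu₂'' : ∀ r ∈ Set.Ioo 0 R, HasDerivAt u₂' (U r * u₂ r - k₂ ^ 2 * u₂ r) r)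
    (hu₁0 : u₁ 0 = 0) (hu₂0 : u₂ 0 = 0)
    (hχ₁' : ∀ r ∈ Set.Icc 0 R, HasDerivAt χ₁ (χ₁' r) r)
    (hχ₂' : ∀ r ∈ Set.Icc 0 R, HasDerivAt χ₂ (χ₂' r) r)
    (hχ₁'c : ContinuousOn χ₁' (Set.Icc 0 R))
    (hχ₂'c : ContinuousOn χ₂' (Set.Icc 0 R))
    (hχ₁'' : ∀ r ∈ Set.Ioo 0 R, HasDerivAt χ₁' (-(k₁ ^ 2 * χ₁ r)) r)
    (hχ₂'' : ∀ r ∈ Set.Ioo 0 R, HasDerivAt χ₂' (-(k₂ ^ 2 * χ₂ r)) r)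
    (hχ₁0 : χ₁ 0 = 1) (hχ₂0 : χ₂ 0 = 1)
    (hmatch₁ : u₁ R = χ₁ R) (hmatch₂ : u₂ R = χ₂ R)
    (hmatch₁' : u₁' R = χ₁' R) (hmatch₂' : u₂' R = χ₂' R) :
    χ₂' 0 - χ₁' 0
      = (k₂ ^ 2 - k₁ ^ 2) * ∫ r in (0:ℝ)..R, (χ₁ r * χ₂ r - u₁ r * u₂ r) := by
  have cu₁ : ContinuousOn u₁ (Set.Icc 0 R) :=
    fun r hr => (hu₁' r hr).continuousAt.continuousWithinAt
  have cu₂ : ContinuousOn u₂ (Set.Icc 0 R) :=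
    fun r hr => (hu₂' r hr).continuousAt.continuousWithinAt
  have cχ₁ : ContinuousOn χ₁ (Set.Icc 0 R) :=
    fun r hr => (hχ₁' r hr).continuousAt.continuousWithinAt
  have cχ₂ : ContinuousOn χ₂ (Set.Icc 0 R) :=
    fun r hr => (hχ₂' r hr).continuousAt.continuousWithinAt
  have key := intervalIntegral.integral_eq_sub_of_hasDerivAt_of_le (a := 0) (b := R)
    (f := fun r => (χ₁' r * χ₂ r - χ₁ r * χ₂' r) - (u₁' r * u₂ r - u₁ r * u₂' r))
    (f' := fun r => (k₂ ^ 2 - k₁ ^ 2) * (χ₁ r * χ₂ r - u₁ r * u₂ r))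
    hR.le
    (((hχ₁'c.mul cχ₂).sub (cχ₁.mul hχ₂'c)).sub ((hu₁'c.mul cu₂).sub (cu₁.mul hu₂'c)))
    (by
      intro r hr
      have hr' := Set.Ioo_subset_Icc_self hr
      have h := (((hχ₁'' r hr).mul (hχ₂' r hr')).sub ((hχ₁' r hr').mul (hχ₂'' r hr))).sub
        (((hu₁'' r hr).mul (hu₂' r hr')).sub ((hu₁' r hr').mul (hu₂'' r hr)))
      refine HasDerivAt.congr_deriv h ?_
      ring)
    (by
      apply ContinuousOn.intervalIntegrable
      rw [Set.uIcc_of_le hR.le]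
      exact continuousOn_const.mul ((cχ₁.mul cχ₂).sub (cu₁.mul cu₂)))
  rw [← intervalIntegral.integral_const_mul, key]
  simp only [hu₁0, hu₂0, hχ₁0, hχ₂0, hmatch₁, hmatch₂, hmatch₁', hmatch₂']
  ring
end

section
/- Let R > 0, a ≠ 0, let U : ℝ → ℝ be continuous on [0, R], and let k ∈ ℝ. Let u₀ : ℝ → ℝ be continuously differentiable on [0, R] and twice differentiable on (0, R) with u₀''(r) = U(r)·u₀(r) on (0, R), u₀(0) = 0, u₀(R) = 1 - R/a, u₀'(R) = -1/a, and set χ₀(r) = 1 - r/a. Let u_k : ℝ → ℝ be continuously differentiable on [0, R] and twice differentiable on (0, R) with -u_k''(r) + U(r)·u_k(r) = k²·u_k(r) on (0, R) and u_k(0) = 0, and let χ_k : ℝ → ℝ be continuously differentiable on [0, R] and twice differentiable on (0, R) with -χ_k''(r) = k²·χ_k(r) on (0, R), χ_k(0) = 1, χ_k(R) = u_k(R), χ_k'(R) = u_k'(R). Then χ_k'(0) = -1/a + k² · ∫₀ᴿ (χ_k(r)·χ₀(r) - u_k(r)·u₀(r)) dr. -/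
/-- Exact representation `χ_k'(0) = -1/a + k² ∫₀ᴿ (χ_k χ₀ - u_k u₀)`, relating
the phase shift function at energy `k²` to the scattering length `a` via the
zero-energy solution `u₀` and the free solutions `χ₀(r) = 1 - r/a`, `χ_k`. -/
theorem phase_shift_scattering_length_identity
    (R a : ℝ) (hR : 0 < R) (ha : a ≠ 0)
    (U : ℝ → ℝ) (hU : ContinuousOn U (Set.Icc 0 R))
    (k : ℝ)
    (u₀ u₀' uk uk' χk χk' : ℝ → ℝ) (χ₀ : ℝ → ℝ)
    (hχ₀def : ∀ r, χ₀ r = 1 - r / a)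
    (hu₀' : ∀ r ∈ Set.Icc 0 R, HasDerivAt u₀ (u₀' r) r)
    (hu₀'c : ContinuousOn u₀' (Set.Icc 0 R))
    (hu₀'' : ∀ r ∈ Set.Ioo 0 R, HasDerivAt u₀' (U r * u₀ r) r)
    (hu₀0 : u₀ 0 = 0) (hu₀R : u₀ R = 1 - R / a) (hu₀'R : u₀' R = -(1 / a))
    (huk' : ∀ r ∈ Set.Icc 0 R, HasDerivAt uk (uk' r) r)
    (huk'c : ContinuousOn uk' (Set.Icc 0 R))
    (huk'' : ∀ r ∈ Set.Ioo 0 R, HasDerivAt uk' (U r * uk r - k ^ 2 * uk r) r)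
    (huk0 : uk 0 = 0)
    (hχk' : ∀ r ∈ Set.Icc 0 R, HasDerivAt χk (χk' r) r)
    (hχk'c : ContinuousOn χk' (Set.Icc 0 R))
    (hχk'' : ∀ r ∈ Set.Ioo 0 R, HasDerivAt χk' (-(k ^ 2 * χk r)) r)
    (hχk0 : χk 0 = 1)
    (hmatch : χk R = uk R) (hmatch' : χk' R = uk' R) :
    χk' 0 = -(1 / a) + k ^ 2 * ∫ r in (0:ℝ)..R, (χk r * χ₀ r - uk r * u₀ r) := by
  have cu0 : ContinuousOn u₀ (Set.Icc 0 R) :=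
    fun r hr => (hu₀' r hr).continuousAt.continuousWithinAt
  have cuk : ContinuousOn uk (Set.Icc 0 R) :=
    fun r hr => (huk' r hr).continuousAt.continuousWithinAt
  have cχk : ContinuousOn χk (Set.Icc 0 R) :=
    fun r hr => (hχk' r hr).continuousAt.continuousWithinAt
  have dχ0 : ∀ r, HasDerivAt χ₀ (-(1 / a)) r := by
    intro r
    have h : χ₀ = fun r => 1 - r / a := funext hχ₀def
    rw [h]
    exact ((hasDerivAt_id r).div_const a).const_sub 1
  have cχ0 : ContinuousOn χ₀ (Set.Icc 0 R) :=
    fun r _ => (dχ0 r).continuousAt.continuousWithinAt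
  have key := intervalIntegral.integral_eq_sub_of_hasDerivAt_of_le (a := 0) (b := R)
    (f := fun r => (uk' r * u₀ r - uk r * u₀' r) - (χk' r * χ₀ r - χk r * (-(1 / a))))
    (f' := fun r => k ^ 2 * (χk r * χ₀ r - uk r * u₀ r)) hR.le
    (((huk'c.mul cu0).sub (cuk.mul hu₀'c)).sub
      ((hχk'c.mul cχ0).sub (cχk.mul continuousOn_const)))
    (by
      intro r hr
      have hr' := Set.Ioo_subset_Icc_self hr
      have h := (((huk'' r hr).mul (hu₀' r hr')).sub ((huk' r hr').mul (hu₀'' r hr))).sub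
        (((hχk'' r hr).mul (dχ0 r)).sub ((hχk' r hr').mul_const (-(1 / a))))
      refine h.congr_deriv ?_
      ring)
    (by
      apply ContinuousOn.intervalIntegrable
      rw [Set.uIcc_of_le hR.le]
      exact continuousOn_const.mul ((cχk.mul cχ0).sub (cuk.mul cu0)))
  rw [intervalIntegral.integral_const_mul] at key
  rw [key]
  simp only [hχ₀def, hu₀0, hu₀R, hu₀'R, huk0, hχk0, hmatch, hmatch']
  ring
end

section
/- Let R > 0 and let U : ℝ → ℝ be continuous on [0, R] with U(r) ≥ 0 for all r ∈ (0, R) and U(r₂) > 0 for some r₂ ∈ (0, R). Let u : ℝ → ℝ be continuously differentiable on [0, R] and twice differentiable on (0, R) with u''(r) = U(r)·u(r) for all r ∈ (0, R), u(0) = 0 and u'(0) = 1. Then u'(R) > 0, and the scattering length a = R - u(R)/u'(R) satisfies 0 < a < R. -/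
/-- A purely repulsive potential (nonnegative, and strictly positive somewhere)
always yields a positive scattering length smaller than the range of the
potential: `u'(R) > 0` and `0 < a < R` where `a = R - u(R)/u'(R)`. -/
theorem repulsive_scattering_length_bounds
    (R : ℝ) (hR : 0 < R)
    (U : ℝ → ℝ) (hU : ContinuousOn U (Set.Icc 0 R))
    (hUnonneg : ∀ r ∈ Set.Ioo 0 R, 0 ≤ U r)
    (r₂ : ℝ) (hr₂ : r₂ ∈ Set.Ioo 0 R) (hUr₂ : 0 < U r₂)
    (u u' : ℝ → ℝ)
    (hu' : ∀ r ∈ Set.Icc 0 R, HasDerivAt u (u' r) r)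
    (hu'c : ContinuousOn u' (Set.Icc 0 R))
    (hu'' : ∀ r ∈ Set.Ioo 0 R, HasDerivAt u' (U r * u r) r)
    (hu0 : u 0 = 0) (hu'0 : u' 0 = 1) :
    0 < u' R ∧ 0 < R - u R / u' R ∧ R - u R / u' R < R := by
  have mono : ∀ f f' : ℝ → ℝ, ContinuousOn f (Set.Icc 0 R) →
      (∀ r ∈ Set.Ioo 0 R, HasDerivAt f (f' r) r) → (∀ r ∈ Set.Ioo 0 R, 0 ≤ f' r) →
      MonotoneOn f (Set.Icc 0 R) := by
    intro f f' hc hd hn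
    apply monotoneOn_of_deriv_nonneg (convex_Icc 0 R) hc
    · intro x hx
      rw [interior_Icc] at hx
      exact (hd x hx).differentiableAt.differentiableWithinAt
    · intro x hx
      rw [interior_Icc] at hx
      rw [(hd x hx).deriv]
      exact hn x hx
  have huc : ContinuousOn u (Set.Icc 0 R) := fun r hr =>
    (hu' r hr).continuousAt.continuousWithinAt
  have h0 : (0:ℝ) ∈ Set.Icc 0 R := ⟨le_rfl, hR.le⟩
  have hRm : R ∈ Set.Icc 0 R := ⟨hR.le, le_rfl⟩
  have hprod : MonotoneOn (fun r => u r * u' r) (Set.Icc 0 R) := by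
    apply mono _ (fun r => u' r * u' r + u r * (U r * u r)) (huc.mul hu'c)
    · intro r hr
      exact (hu' r (Set.Ioo_subset_Icc_self hr)).mul (hu'' r hr)
    · intro r hr
      have := hUnonneg r hr
      have h2 : 0 ≤ U r * (u r * u r) := mul_nonneg this (mul_self_nonneg _)
      nlinarith [mul_self_nonneg (u' r)]
  have hsq : MonotoneOn (fun r => u r * u r) (Set.Icc 0 R) := by
    apply mono _ (fun r => u' r * u r + u r * u' r) (huc.mul huc)
    · intro r hr
      have := hu' r (Set.Ioo_subset_Icc_self hr)
      exact this.mul this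
    · intro r hr
      have := hprod h0 (Set.Ioo_subset_Icc_self hr) hr.1.le
      simp only [hu0, zero_mul] at this
      nlinarith
  have hpos : ∀ r ∈ Set.Ioc 0 R, 0 < u r := by
    intro r hr
    by_contra! hneg
    -- a small point where `u` is positive
    obtain ⟨s, hs0, hsr, hs⟩ : ∃ s, 0 < s ∧ s < r ∧ 0 < u s := by
      have hd := hu' 0 h0
      rw [hu'0, hasDerivAt_iff_tendsto_slope] at hd
      have hd2 := hd.mono_left (nhdsWithin_mono (0:ℝ)
        (show Set.Ioi (0:ℝ) ⊆ {0}ᶜ from fun x hx => ne_of_gt hx))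
      have he := hd2.eventually (lt_mem_nhds (show (0:ℝ) < 1 by norm_num))
      obtain ⟨s, hs, hs2⟩ := (he.and (Ioo_mem_nhdsGT hr.1)).exists
      refine ⟨s, hs2.1, hs2.2, ?_⟩
      rw [slope_def_field, hu0, sub_zero, sub_zero] at hs
      exact (div_pos_iff_of_pos_right hs2.1).1 hs
    have hsub : Set.Icc s r ⊆ Set.Icc 0 R := Set.Icc_subset_Icc hs0.le hr.2
    obtain ⟨t, ht, ht0⟩ := intermediate_value_Icc' hsr.le (huc.mono hsub) ⟨hneg, hs.le⟩
    have := hsq (hsub ⟨le_rfl, hsr.le⟩) (hsub ht) ht.1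
    simp only [ht0, mul_zero] at this
    nlinarith
  have hu'mono : MonotoneOn u' (Set.Icc 0 R) :=
    mono u' _ hu'c hu'' fun r hr =>
      mul_nonneg (hUnonneg r hr) (hpos r (Set.Ioo_subset_Ioc_self hr)).le
  have hu'R : 0 < u' R := by
    have := hu'mono h0 hRm hR.le
    linarith
  have huR := hpos R ⟨hR, le_rfl⟩
  have hwd : ∀ r ∈ Set.Ioo 0 R, HasDerivAt (fun r => r * u' r - u r) (r * (U r * u r)) r := by
    intro r hr
    have := ((hasDerivAt_id r).mul (hu'' r hr)).sub (hu' r (Set.Ioo_subset_Icc_self hr))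
    refine HasDerivAt.congr_deriv this ?_
    simp only [id]
    ring
  have hw : MonotoneOn (fun r => r * u' r - u r) (Set.Icc 0 R) :=
    mono _ _ ((continuousOn_id.mul hu'c).sub huc) hwd fun r hr =>
      mul_nonneg hr.1.le (mul_nonneg (hUnonneg r hr) (hpos r (Set.Ioo_subset_Ioc_self hr)).le)
  have hwR : 0 < R * u' R - u R := by
    by_contra! hle
    have hev : (fun r => r * u' r - u r) =ᶠ[nhds r₂] fun _ => (0:ℝ) := by
      filter_upwards [Ioo_mem_nhds hr₂.1 hr₂.2] with r hr
      have h1 := hw h0 (Set.Ioo_subset_Icc_self hr) hr.1.le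
      have h2 := hw (Set.Ioo_subset_Icc_self hr) hRm hr.2.le
      simp only [hu0] at h1 h2
      linarith
    have hz := (hwd r₂ hr₂).unique ((hasDerivAt_const r₂ (0:ℝ)).congr_of_eventuallyEq hev)
    have := mul_pos hr₂.1 (mul_pos hUr₂ (hpos r₂ (Set.Ioo_subset_Ioc_self hr₂)))
    linarith
  refine ⟨hu'R, ?_, ?_⟩
  · rw [sub_pos, div_lt_iff₀ hu'R]
    linarith
  · have := div_pos huR hu'R
    linarith
end

section
/- Let R > 0 and let U : ℝ → ℝ be continuous on [0, R] with U(r) ≤ 0 for all r ∈ (0, R) and U(r₂) < 0 for some r₂ ∈ (0, R). Let u : ℝ → ℝ be continuously differentiable on [0, R] and twice differentiable on (0, R) with u''(r) = U(r)·u(r) for all r ∈ (0, R), u(0) = 0, u'(0) = 1, and u(r) > 0 for all r ∈ (0, R]. Then u(R) > R·u'(R); consequently, if in addition u'(R) > 0, the scattering length a = R - u(R)/u'(R) is strictly negative. -/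
/-- An attractive potential (nonpositive, strictly negative somewhere) that is
not strong enough to bind (`u > 0` on `(0, R]`) satisfies `u(R) > R·u'(R)`;
hence, if `u'(R) > 0`, the scattering length `a = R - u(R)/u'(R)` is strictly
negative. -/
theorem attractive_no_bound_state_negative_scattering_length
    (R : ℝ) (hR : 0 < R)
    (U : ℝ → ℝ) (hU : ContinuousOn U (Set.Icc 0 R))
    (hUnonpos : ∀ r ∈ Set.Ioo 0 R, U r ≤ 0)
    (r₂ : ℝ) (hr₂ : r₂ ∈ Set.Ioo 0 R) (hUr₂ : U r₂ < 0)
    (u u' : ℝ → ℝ)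
    (hu' : ∀ r ∈ Set.Icc 0 R, HasDerivAt u (u' r) r)
    (hu'c : ContinuousOn u' (Set.Icc 0 R))
    (hu'' : ∀ r ∈ Set.Ioo 0 R, HasDerivAt u' (U r * u r) r)
    (hu0 : u 0 = 0) (hu'0 : u' 0 = 1)
    (hupos : ∀ r ∈ Set.Ioc 0 R, 0 < u r) :
    R * u' R < u R ∧ (0 < u' R → R - u R / u' R < 0) := by
  have hder : ∀ r ∈ Set.Ioo 0 R, HasDerivAt (fun x => u x - x * u' x) (-(r * (U r * u r))) r := by
    intro r hr
    have h := (hu' r ⟨hr.1.le, hr.2.le⟩).sub ((hasDerivAt_id r).mul (hu'' r hr))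
    refine h.congr_deriv ?_
    simp only [id]
    ring
  have hcont : ContinuousOn (fun x => u x - x * u' x) (Set.Icc 0 R) := by
    have hu : ContinuousOn u (Set.Icc 0 R) := fun r hr =>
      (hu' r hr).continuousAt.continuousWithinAt
    exact hu.sub (continuousOn_id.mul hu'c)
  have hmono : MonotoneOn (fun x => u x - x * u' x) (Set.Icc 0 R) := by
    refine monotoneOn_of_deriv_nonneg (convex_Icc 0 R) hcont ?_ ?_
    · rw [interior_Icc]
      exact fun r hr => (hder r hr).differentiableAt.differentiableWithinAt
    · rw [interior_Icc]
      intro r hr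
      rw [(hder r hr).deriv]
      have h1 := mul_nonpos_of_nonpos_of_nonneg (hUnonpos r hr) (hupos r ⟨hr.1, hr.2.le⟩).le
      have h2 := mul_nonpos_of_nonneg_of_nonpos hr.1.le h1
      linarith
  have main : R * u' R < u R := by
    by_contra hcon
    push Not at hcon
    have hzero : ∀ r ∈ Set.Ioo 0 R, u r - r * u' r = 0 := by
      intro r hr
      have h1 := hmono ⟨le_refl 0, hR.le⟩ ⟨hr.1.le, hr.2.le⟩ hr.1.le
      have h2 := hmono ⟨hr.1.le, hr.2.le⟩ ⟨hR.le, le_refl R⟩ hr.2.le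
      simp only [hu0] at h1 h2
      linarith
    have hev : (fun x => u x - x * u' x) =ᶠ[nhds r₂] fun _ => (0 : ℝ) := by
      filter_upwards [Ioo_mem_nhds hr₂.1 hr₂.2] with r hr using hzero r hr
    have h0 := (hder r₂ hr₂).deriv
    rw [hev.deriv_eq, deriv_const] at h0
    have h1 := mul_neg_of_neg_of_pos hUr₂ (hupos r₂ ⟨hr₂.1, hr₂.2.le⟩)
    have h2 := mul_neg_of_pos_of_neg hr₂.1 h1
    linarith
  refine ⟨main, fun h => ?_⟩
  rw [sub_neg, lt_div_iff₀ h]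
  exact main
end

section
/- Let R > 0 and a > R be real numbers. Let U : ℝ → ℝ be continuous with U(r) ≤ 0 for all r ∈ (0, R). Let u : ℝ → ℝ be continuously differentiable on ℝ and twice differentiable on (0, R) with u''(r) = U(r)·u(r) for all r ∈ (0, R), u(0) = 0, u(r) = 1 - r/a for all r ≥ R, and u(r) > 0 for all r ∈ (0, R]. Then the effective range r₀ = 2∫₀ᴿ ((1 - r/a)² - u(r)²) dr is strictly positive. -/
/-- Classical result (Landau, Smorodinskii): the effective range of a purely
attractive finite-range potential with scattering length `a > R` is strictly
positive. -/
theorem effective_range_pos_attractive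
    (R a : ℝ) (hR : 0 < R) (ha : R < a)
    (U : ℝ → ℝ) (hU : Continuous U)
    (hUatt : ∀ r ∈ Set.Ioo 0 R, U r ≤ 0)
    (u : ℝ → ℝ) (hu : ContDiff ℝ 1 u)
    (hu'' : ∀ r ∈ Set.Ioo 0 R, HasDerivAt (deriv u) (U r * u r) r)
    (hu0 : u 0 = 0)
    (huR : ∀ r, R ≤ r → u r = 1 - r / a)
    (hupos : ∀ r ∈ Set.Ioc 0 R, 0 < u r) :
    0 < 2 * ∫ r in (0:ℝ)..R, ((1 - r / a) ^ 2 - u r ^ 2) := by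
  have hane : 0 < a := hR.trans ha
  have hd : ∀ r, HasDerivAt u (deriv u r) r := fun r =>
    (hu.differentiable (by norm_num) r).hasDerivAt
  have hl : ∀ r, HasDerivAt (fun r : ℝ => 1 - r / a) (-(1 / a)) r := fun r => by
    simpa using ((hasDerivAt_id r).div_const a).const_sub 1
  have hdc : Continuous (deriv u) := hu.continuous_deriv (by norm_num)
  have hdR : deriv u R = -(1 / a) := by
    have h1 : HasDerivWithinAt u (deriv u R) (Set.Ici R) R := (hd R).hasDerivWithinAt
    have h2 : HasDerivWithinAt u (-(1 / a)) (Set.Ici R) R :=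
      (hl R).hasDerivWithinAt.congr (fun r hr => huR r hr) (huR R le_rfl)
    exact (uniqueDiffOn_Ici R R Set.self_mem_Ici).eq_deriv _ h1 h2
  have hanti : AntitoneOn (deriv u) (Set.Icc 0 R) := by
    apply antitoneOn_of_deriv_nonpos (convex_Icc 0 R) hdc.continuousOn
    · intro r hr
      rw [interior_Icc] at hr
      exact (hu'' r hr).differentiableAt.differentiableWithinAt
    · intro r hr
      rw [interior_Icc] at hr
      rw [(hu'' r hr).deriv]
      exact mul_nonpos_of_nonpos_of_nonneg (hUatt r hr) (hupos r ⟨hr.1, hr.2.le⟩).le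
  have hmono : MonotoneOn (fun r => u r - (1 - r / a)) (Set.Icc 0 R) := by
    have hg : ∀ r, HasDerivAt (fun r => u r - (1 - r / a)) (deriv u r - -(1 / a)) r :=
      fun r => (hd r).sub (hl r)
    apply monotoneOn_of_deriv_nonneg (convex_Icc 0 R)
    · exact fun r _ => (hg r).continuousAt.continuousWithinAt
    · exact fun r _ => (hg r).differentiableAt.differentiableWithinAt
    · intro r hr
      rw [interior_Icc] at hr
      rw [(hg r).deriv, ← hdR]
      exact sub_nonneg.2 (hanti ⟨hr.1.le, hr.2.le⟩ ⟨hR.le, le_rfl⟩ hr.2.le)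
  have hle : ∀ r ∈ Set.Icc 0 R, u r ≤ 1 - r / a := by
    intro r hr
    have := hmono hr ⟨hR.le, le_rfl⟩ hr.2
    simp only [huR R le_rfl, sub_self] at this
    linarith
  have huc := hu.continuous
  apply mul_pos two_pos
  apply intervalIntegral.integral_pos hR
  · fun_prop
  · intro r hr
    have h0 := (hupos r hr).le
    have h1 := hle r ⟨hr.1.le, hr.2⟩
    nlinarith
  · exact ⟨0, ⟨le_rfl, hR.le⟩, by simp [hu0]⟩
end

section
/- Let r₁ ∈ (0, 1) and set k₂ = π/(2(1 - r₁)). Define u : ℝ → ℝ by u(r) = 0 for r ∈ [0, r₁), u(r) = cos(k₂(1 - r)) for r ∈ [r₁, 1), and u(r) = 1 for r ≥ 1. Then 2∫₀¹ (1 - u(r)²) dr = 1 + r₁. -/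
/-- The effective range of the barrier–well system in the unitarity limit with
an infinite repulsive core on `[0, r₁)`: the zero-energy wave function vanishes
on the core, equals `cos(k₂(1 - r))` with `k₂ = π/(2(1 - r₁))` in the well, and
equals `1` outside; the effective range is `1 + r₁` in units of the range. -/
theorem effective_range_infinite_barrier_well
    (r₁ : ℝ) (hr₁ : r₁ ∈ Set.Ioo 0 1)
    (k₂ : ℝ) (hk₂ : k₂ = Real.pi / (2 * (1 - r₁)))
    (u : ℝ → ℝ)
    (hcore : ∀ r ∈ Set.Ico (0:ℝ) r₁, u r = 0)
    (hwell : ∀ r ∈ Set.Ico r₁ (1:ℝ), u r = Real.cos (k₂ * (1 - r)))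
    (hout : ∀ r : ℝ, 1 ≤ r → u r = 1) :
    2 * ∫ r in (0:ℝ)..1, (1 - u r ^ 2) = 1 + r₁ := by
  obtain ⟨h0, h1⟩ := hr₁
  have hpos : 0 < 1 - r₁ := by linarith
  have hk : k₂ ≠ 0 := by
    rw [hk₂]; have := Real.pi_pos; positivity
  have hkr : k₂ * (1 - r₁) = Real.pi / 2 := by
    rw [hk₂]; field_simp
  have e1 : Set.EqOn (fun _ : ℝ => (1:ℝ)) (fun r => 1 - u r ^ 2) (Set.uIcc 0 r₁) := by
    intro r hr
    rw [Set.uIcc_of_le h0.le] at hr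
    have : u r = 0 := by
      rcases hr.2.lt_or_eq with h | h
      · exact hcore r ⟨hr.1, h⟩
      · rw [h, hwell r₁ ⟨le_refl _, h1⟩, hkr, Real.cos_pi_div_two]
    simp [this]
  have e2 : Set.EqOn (fun r : ℝ => 1 - Real.cos (k₂ * (1 - r)) ^ 2)
      (fun r => 1 - u r ^ 2) (Set.uIcc r₁ 1) := by
    intro r hr
    rw [Set.uIcc_of_le h1.le] at hr
    have : u r = Real.cos (k₂ * (1 - r)) := by
      rcases hr.2.lt_or_eq with h | h
      · exact hwell r ⟨hr.1, h⟩
      · rw [h, hout 1 le_rfl]; simp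
    simp [this]
  have c2 : Continuous (fun r : ℝ => 1 - Real.cos (k₂ * (1 - r)) ^ 2) := by fun_prop
  have i1 : IntervalIntegrable (fun r => 1 - u r ^ 2) MeasureTheory.volume 0 r₁ :=
    (continuousOn_const.congr e1.symm).intervalIntegrable
  have i2 : IntervalIntegrable (fun r => 1 - u r ^ 2) MeasureTheory.volume r₁ 1 :=
    (c2.continuousOn.congr e2.symm).intervalIntegrable
  have I2 : ∫ r in r₁..1, (1 - Real.cos (k₂ * (1 - r)) ^ 2) = (1 - r₁) / 2 := by
    have hd : ∀ r ∈ Set.uIcc r₁ 1,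
        HasDerivAt (fun r : ℝ => r / 2 + Real.sin (2 * (k₂ * (1 - r))) / (4 * k₂))
          (1 - Real.cos (k₂ * (1 - r)) ^ 2) r := by
      intro r _
      have a : HasDerivAt (fun r : ℝ => 2 * (k₂ * (1 - r))) (2 * (k₂ * (-1))) r :=
        (((hasDerivAt_id r).const_sub 1).const_mul k₂).const_mul 2
      have b := ((hasDerivAt_id r).div_const 2).add (a.sin.div_const (4 * k₂))
      refine b.congr_deriv ?_
      rw [Real.cos_two_mul]
      field_simp
      ring
    rw [intervalIntegral.integral_eq_sub_of_hasDerivAt hd (c2.intervalIntegrable _ _), hkr]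
    have : 2 * (Real.pi / 2) = Real.pi := by ring
    rw [this]
    simp
    ring
  rw [← intervalIntegral.integral_add_adjacent_intervals i1 i2,
    ← intervalIntegral.integral_congr e1, ← intervalIntegral.integral_congr e2, I2]
  simp
  ring
end
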